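/- arXiv:math/0007116 — 7 statements merged into one kernel-verified Lean document; each statement's English description precedes it below -/
import Mathlib

section
/- Assume 4 divides n. Then for every v ∈ L₀, the vector ½·v·(I+W) lies in L₀. (That is, the Dₙ root lattice L₀ is stable under multiplication by ½(1+√−l), and hence is a module over the ring of integers ℤ[½(1+√−l)].) -/
open Matrix

section SignMatrix

variable {ι : Type*} [Fintype ι] {H : Matrix ι ι ℤ}

/-- A row sum of a `±1` matrix has the parity of the number of columns. -/
theorem two_dvd_card_sub_rowSum (hH : ∀ i j, H i j = 1 ∨ H i j = -1) (i : ι) :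
    (2 : ℤ) ∣ Fintype.card ι - ∑ j, H i j := by
  have h : (Fintype.card ι : ℤ) - ∑ j, H i j = ∑ j, (1 - H i j) := by simp
  rw [h]
  refine Finset.dvd_sum fun j _ => ?_
  rcases hH i j with h | h <;> simp [h]

/-- Row sums of orthogonal rows of a `±1` matrix add up to the order modulo `4`. -/
theorem four_dvd_card_sub_rowSum_add (hH : ∀ i j, H i j = 1 ∨ H i j = -1) {i k : ι}
    (hik : ∑ j, H i j * H k j = 0) :
    (4 : ℤ) ∣ Fintype.card ι - (∑ j, H i j + ∑ j, H k j) := by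
  have h : (Fintype.card ι : ℤ) - (∑ j, H i j + ∑ j, H k j) =
      ∑ j, (1 - H i j) * (1 - H k j) := by
    simp only [sub_mul, mul_sub, one_mul, mul_one, Finset.sum_sub_distrib, hik]
    simp
    ring
  rw [h]
  refine Finset.dvd_sum fun j _ => ?_
  rcases hH i j with h | h <;> rcases hH k j with h' | h' <;> simp [h, h']

/-- Each entry of `a ᵥ* H`, for a `±1` matrix `H`, has the parity of the entry sum of `a`. -/
theorem two_dvd_vecMul_apply (hH : ∀ i j, H i j = 1 ∨ H i j = -1) {a : ι → ℤ}
    (ha : 2 ∣ ∑ i, a i) (j : ι) : 2 ∣ (a ᵥ* H) j := by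
  have h : (a ᵥ* H) j = ∑ i, a i - ∑ i, a i * (1 - H i j) := by
    simp [Matrix.vecMul, dotProduct, mul_sub]
  rw [h]
  refine dvd_sub ha (Finset.dvd_sum fun i _ => Dvd.dvd.mul_left ?_ _)
  rcases hH i j with h | h <;> simp [h]

/-- For a Hadamard matrix `H` of order divisible by `4` and an integral vector `a` with even
entry sum, the entry sum of `a ᵥ* H` is divisible by `4`. -/
theorem four_dvd_sum_vecMul (hH : ∀ i j, H i j = 1 ∨ H i j = -1)
    (horth : ∀ i k, i ≠ k → ∑ j, H i j * H k j = 0) (h4 : 4 ∣ Fintype.card ι)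
    {a : ι → ℤ} (ha : 2 ∣ ∑ i, a i) : 4 ∣ ∑ j, (a ᵥ* H) j := by
  rcases isEmpty_or_nonempty ι with _ | ⟨⟨o⟩⟩
  · simp
  have hcard : (4 : ℤ) ∣ Fintype.card ι := by exact_mod_cast h4
  have hswap : ∑ j, (a ᵥ* H) j =
      ∑ i, a i * (∑ j, H i j - ∑ j, H o j) + (∑ i, a i) * ∑ j, H o j := by
    simp only [Matrix.vecMul, dotProduct, mul_sub, Finset.sum_sub_distrib, Finset.sum_mul]
    rw [Finset.sum_comm]
    simp [Finset.mul_sum]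
  have ho := two_dvd_card_sub_rowSum hH o
  rw [hswap]
  refine dvd_add (Finset.dvd_sum fun i _ => Dvd.dvd.mul_left ?_ _) ?_
  · rcases eq_or_ne i o with rfl | hio
    · simp
    · have := four_dvd_card_sub_rowSum_add hH (horth i o hio)
      omega
  · exact mul_dvd_mul ha (by omega : (2 : ℤ) ∣ ∑ j, H o j)

end SignMatrix

/-- If `W` is a skew-symmetric conference matrix, then `1 + W` is an integral Hadamard matrix. -/
theorem exists_int_hadamard_of_skew_conference {n : ℕ} {W : Matrix (Fin n) (Fin n) ℝ}
    (hdiag : ∀ i, W i i = 0) (hoff : ∀ i j, i ≠ j → W i j = 1 ∨ W i j = -1)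
    (hskew : Wᵀ = -W) (hconf : W * Wᵀ = ((n : ℝ) - 1) • 1) :
    ∃ H : Matrix (Fin n) (Fin n) ℤ, 1 + W = H.map (Int.cast : ℤ → ℝ) ∧
      (∀ i j, H i j = 1 ∨ H i j = -1) ∧ ∀ i k, i ≠ k → ∑ j, H i j * H k j = 0 := by
  have hent : ∀ i j, ∃ h : ℤ, (1 + W) i j = h ∧ (h = 1 ∨ h = -1) := by
    intro i j
    rcases eq_or_ne i j with rfl | hij
    · exact ⟨1, by simp [hdiag], Or.inl rfl⟩
    · rcases hoff i j hij with h | h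
      · exact ⟨1, by simp [h, hij], Or.inl rfl⟩
      · exact ⟨-1, by simp [h, hij], Or.inr rfl⟩
  choose H hHW hH using hent
  refine ⟨H, Matrix.ext hHW, hH, fun i k hik => ?_⟩
  have hmul : (1 + W) * (1 + W)ᵀ = (n : ℝ) • 1 := by
    have h : (1 + W) * (1 + W)ᵀ = 1 + (W + Wᵀ) + W * Wᵀ := by
      rw [transpose_add, transpose_one]
      noncomm_ring
    rw [h, hconf, hskew, sub_smul, one_smul]
    abel
  have hentry := congrFun (congrFun hmul i) k
  simp only [Matrix.mul_apply, transpose_apply, hHW, Matrix.smul_apply,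
    Matrix.one_apply_ne hik, smul_zero] at hentry
  exact_mod_cast hentry

/-- Lemma 2: if `4 ∣ n`, the `Dₙ` root lattice `L₀` is stable under multiplication by
`½(1 + √-l)`, i.e. for every `v ∈ L₀` the vector `½·v·(I + W)` lies in `L₀`. -/
theorem stmt_3 (n : ℕ) (hn : 0 < n) (W : Matrix (Fin n) (Fin n) ℝ)
    (hdiag : ∀ i, W i i = 0)
    (hoff : ∀ i j, i ≠ j → W i j = 1 ∨ W i j = -1)
    (hskew : Wᵀ = -W)
    (hconf : W * Wᵀ = ((n : ℝ) - 1) • 1)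
    (h4 : 4 ∣ n)
    (L0 : Set (Fin n → ℝ))
    (hL0 : L0 = {v | ∃ a : Fin n → ℤ, (∀ i, v i = (a i : ℝ)) ∧ 2 ∣ ∑ i, a i})
    (v : Fin n → ℝ) (hv : v ∈ L0) :
    (2⁻¹ : ℝ) • Matrix.vecMul v (1 + W) ∈ L0 := by
  subst hL0
  obtain ⟨a, hva, ha⟩ := hv
  obtain ⟨H, hHW, hH, horth⟩ := exists_int_hadamard_of_skew_conference hdiag hoff hskew hconf
  choose c hc using two_dvd_vecMul_apply hH ha
  refine ⟨c, fun j => ?_, ?_⟩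
  · have hj : (v ᵥ* (1 + W)) j = ((a ᵥ* H) j : ℤ) := by
      rw [hHW]
      simp [Matrix.vecMul, dotProduct, hva]
    rw [Pi.smul_apply, hj, hc j]
    simp
  · have h := four_dvd_sum_vecMul hH horth (by simpa using h4) ha
    simp only [hc, ← Finset.mul_sum] at h
    omega
end

section
/- Assume 8 divides n. Then for every v ∈ L₊ the vector ½·v·(I+W) lies in L₊, and for every v ∈ L₋ the vector ½·v·(I+W) lies in L₋. (That is, both lattices L₊ and L₋, each isometric to Dₙ⁺, are stable under multiplication by ½(1+√−l).) -/
open Matrix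

/-- If the Gram matrix of an odd integer matrix vanishes modulo `4`, then half of an even-sum
integer combination of its rows is again an integer vector with even sum. -/
theorem exists_half_vecMul_of_odd {n : ℕ} (h4 : 4 ∣ n) (R : Matrix (Fin n) (Fin n) ℤ)
    (hodd : ∀ i j, Odd (R i j)) (hR : ∀ i k, 4 ∣ (R * Rᵀ) i k)
    (a : Fin n → ℤ) (ha : 2 ∣ ∑ i, a i) :
    ∃ b : Fin n → ℤ, vecMul a R = 2 • b ∧ 2 ∣ ∑ j, b j := by
  have h4' : (4 : ℤ) ∣ n := by exact_mod_cast h4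
  have hdvd : ∀ j, 2 ∣ vecMul a R j := by
    intro j
    have h : (2 : ℤ) ∣ ∑ i, a i * (R i j - 1) := Finset.dvd_sum fun i _ => by
      obtain ⟨k, hk⟩ := hodd i j
      exact ⟨a i * k, by rw [hk]; ring⟩
    have e : vecMul a R j = ∑ i, a i * (R i j - 1) + ∑ i, a i := by
      simp only [vecMul, dotProduct, ← Finset.sum_add_distrib]
      exact Finset.sum_congr rfl fun i _ => by ring
    rw [e]
    exact dvd_add h ha
  choose b hb using hdvd
  refine ⟨b, funext fun j => by simpa using hb j, ?_⟩
  rcases Nat.eq_zero_or_pos n with rfl | hn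
  · simp
  have hrow : ∀ i k, (4 : ℤ) ∣ ∑ j, R i j + ∑ j, R k j := by
    intro i k
    have h : (4 : ℤ) ∣ ∑ j, (1 - R i j) * (1 - R k j) := Finset.dvd_sum fun j _ => by
      obtain ⟨x, hx⟩ := hodd i j
      obtain ⟨y, hy⟩ := hodd k j
      exact ⟨x * y, by rw [hx, hy]; ring⟩
    have e : ∑ j, (1 - R i j) * (1 - R k j)
        = n + (R * Rᵀ) i k - (∑ j, R i j + ∑ j, R k j) := by
      have hc : (n : ℤ) = ∑ _j : Fin n, 1 := by simp
      rw [hc]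
      simp only [mul_apply, transpose_apply, ← Finset.sum_add_distrib, ← Finset.sum_sub_distrib]
      exact Finset.sum_congr rfl fun j _ => by ring
    rw [e] at h
    have := hR i k
    omega
  let o : Fin n := ⟨0, hn⟩
  have hsum : 2 * ∑ j, b j
      = ∑ i, a i * (∑ j, R i j + ∑ j, R o j) - (∑ i, a i) * ∑ j, R o j := by
    have hv : ∀ j, 2 * b j = ∑ i, a i * R i j := fun j => (hb j).symm
    rw [Finset.mul_sum, Finset.sum_congr rfl fun j _ => hv j, Finset.sum_mul,
      ← Finset.sum_sub_distrib, Finset.sum_comm]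
    exact Finset.sum_congr rfl fun i _ => by rw [← Finset.mul_sum]; ring
  have h1 : (4 : ℤ) ∣ ∑ i, a i * (∑ j, R i j + ∑ j, R o j) :=
    Finset.dvd_sum fun i _ => (hrow i o).mul_left _
  have h2 : (4 : ℤ) ∣ (∑ i, a i) * ∑ j, R o j := by
    have : (2 : ℤ) ∣ ∑ j, R o j := by have := hrow o o; omega
    exact mul_dvd_mul ha this
  omega

/-- Lemma 3: if `8 ∣ n`, the lattices `L₊` and `L₋` (each isometric to `Dₙ⁺`) are stable
under multiplication by `½(1 + √-l)`. -/
theorem stmt_4 (n : ℕ) (hn : 0 < n) (W : Matrix (Fin n) (Fin n) ℝ)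
    (hdiag : ∀ i, W i i = 0)
    (hoff : ∀ i j, i ≠ j → W i j = 1 ∨ W i j = -1)
    (hskew : Wᵀ = -W)
    (hconf : W * Wᵀ = ((n : ℝ) - 1) • 1)
    (h8 : 8 ∣ n)
    (L0 : Set (Fin n → ℝ))
    (hL0 : L0 = {v | ∃ a : Fin n → ℤ, (∀ i, v i = (a i : ℝ)) ∧ 2 ∣ ∑ i, a i})
    (Lplus Lminus : AddSubgroup (Fin n → ℝ))
    (hLp : Lplus = AddSubgroup.closure
      (L0 ∪ {(2⁻¹ : ℝ) • Matrix.vecMul (Pi.single (⟨0, hn⟩ : Fin n) 1) (1 + W)}))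
    (hLm : Lminus = AddSubgroup.closure
      (L0 ∪ {(2⁻¹ : ℝ) • Matrix.vecMul (Pi.single (⟨0, hn⟩ : Fin n) 1) (-1 + W)})) :
    (∀ v ∈ Lplus, (2⁻¹ : ℝ) • Matrix.vecMul v (1 + W) ∈ Lplus) ∧
    (∀ v ∈ Lminus, (2⁻¹ : ℝ) • Matrix.vecMul v (1 + W) ∈ Lminus) := by
  have hn4 : (4 : ℤ) ∣ n := by exact_mod_cast (show 4 ∣ 8 by norm_num).trans h8
  have hsq : W * W = (1 - (n : ℝ)) • (1 : Matrix (Fin n) (Fin n) ℝ) := by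
    rw [hskew, mul_neg] at hconf
    rw [← neg_neg (W * W), hconf, ← neg_smul, neg_sub]
  have hgram : (1 + W) * (1 + W)ᵀ = (n : ℝ) • (1 : Matrix (Fin n) (Fin n) ℝ) := by
    rw [transpose_add, transpose_one, hskew, mul_add, add_mul, add_mul, mul_neg, mul_neg, hsq]
    simp only [one_mul, mul_one]
    module
  have hent : ∀ i j, ∃ z : ℤ, Odd z ∧ (1 + W) i j = z := by
    intro i j
    rcases eq_or_ne i j with rfl | h
    · exact ⟨1, odd_one, by simp [hdiag]⟩
    · rcases hoff i j h with h' | h'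
      · exact ⟨1, odd_one, by simp [h, h']⟩
      · exact ⟨-1, by decide, by simp [h, h']⟩
  choose R hodd hRW using hent
  have hR : ∀ i k, 4 ∣ (Matrix.of R * (Matrix.of R)ᵀ) i k := by
    intro i k
    have h := congrFun (congrFun hgram i) k
    have h' : (((Matrix.of R * (Matrix.of R)ᵀ) i k : ℤ) : ℝ)
        = (((n : ℤ) * (1 : Matrix (Fin n) (Fin n) ℤ) i k : ℤ) : ℝ) := by
      simp only [mul_apply, transpose_apply, hRW] at h
      simp only [mul_apply, transpose_apply, of_apply]
      push_cast
      rw [h]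
      simp [one_apply]
    rw [Int.cast_injective h']
    exact hn4.mul_right _
  have hL0A : ∀ v ∈ L0, (2⁻¹ : ℝ) • vecMul v (1 + W) ∈ L0 := by
    subst hL0
    rintro v ⟨a, hva, ha⟩
    obtain ⟨b, hb, hb2⟩ := exists_half_vecMul_of_odd ((show 4 ∣ 8 by norm_num).trans h8)
      (Matrix.of R) hodd hR a ha
    refine ⟨b, fun j => ?_, hb2⟩
    have h := congrArg (Int.cast (R := ℝ)) (congrFun hb j)
    simp only [vecMul, dotProduct, of_apply, Pi.smul_apply, nsmul_eq_mul, smul_eq_mul] at h ⊢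
    push_cast at h
    simp only [hva, hRW, h]
    ring
  set e : Fin n → ℝ := Pi.single (⟨0, hn⟩ : Fin n) 1 with he
  have heL0 : (n / 4 : ℝ) • e ∈ L0 := by
    subst hL0
    obtain ⟨m, rfl⟩ := h8
    refine ⟨Pi.single ⟨0, hn⟩ (2 * m), fun i => ?_, by simp⟩
    rw [he]
    rcases eq_or_ne i ⟨0, hn⟩ with rfl | h
    · simp; ring
    · simp [h]
  have hstable : ∀ g : Fin n → ℝ,
      (2⁻¹ : ℝ) • vecMul g (1 + W) ∈ AddSubgroup.closure (L0 ∪ {g}) →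
      ∀ v ∈ AddSubgroup.closure (L0 ∪ {g}),
        (2⁻¹ : ℝ) • vecMul v (1 + W) ∈ AddSubgroup.closure (L0 ∪ {g}) := by
    intro g hg v hv
    induction hv using AddSubgroup.closure_induction with
    | mem x hx =>
      rcases hx with hx | rfl
      · exact AddSubgroup.subset_closure (Or.inl (hL0A x hx))
      · exact hg
    | zero => simp
    | add x y _ _ hx hy => rw [add_vecMul, smul_add]; exact add_mem hx hy
    | neg x _ hx => rw [neg_vecMul, smul_neg]; exact neg_mem hx
  subst hLp hLm
  refine ⟨hstable _ ?_, hstable _ ?_⟩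
  · have h : (2⁻¹ : ℝ) • vecMul ((2⁻¹ : ℝ) • vecMul e (1 + W)) (1 + W)
        = (2⁻¹ : ℝ) • vecMul e (1 + W) - (n / 4 : ℝ) • e := by
      have hA : (1 + W) * (1 + W) = (2 : ℝ) • (1 + W) - (n : ℝ) • 1 := by
        rw [mul_add, add_mul, add_mul, hsq]
        simp only [one_mul, mul_one]
        module
      rw [smul_vecMul, vecMul_vecMul, hA, vecMul_sub, vecMul_smul, vecMul_smul, vecMul_one]
      module
    rw [h]
    exact sub_mem (AddSubgroup.subset_closure (Or.inr rfl))
      (AddSubgroup.subset_closure (Or.inl heL0))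
  · have h : (2⁻¹ : ℝ) • vecMul ((2⁻¹ : ℝ) • vecMul e (-1 + W)) (1 + W)
        = -((n / 4 : ℝ) • e) := by
      have hA : (-1 + W) * (1 + W) = -((n : ℝ) • 1) := by
        rw [mul_add, add_mul, add_mul, hsq]
        simp only [neg_mul, one_mul, mul_one]
        module
      rw [smul_vecMul, vecMul_vecMul, hA, vecMul_neg, vecMul_smul, vecMul_one]
      module
    rw [h]
    exact neg_mem (AddSubgroup.subset_closure (Or.inl heL0))
end

section
/- The Paley matrix W is a skew-symmetric conference matrix of order n = l+1: its diagonal entries are zero, its off-diagonal entries are 1 or −1, Wᵀ = −W, and W·Wᵀ = l·I. -/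
open Matrix

/-- The autocorrelation of the quadratic character of a finite field of odd characteristic at a
nonzero shift is `-1`. -/
theorem sum_quadraticChar_mul_quadraticChar_add {F : Type*} [Field F] [Fintype F] [DecidableEq F]
    (hF : ringChar F ≠ 2) {c : F} (hc : c ≠ 0) :
    ∑ x : F, quadraticChar F x * quadraticChar F (x + c) = -1 := by
  have hJ := jacobiSum_nontrivial_inv (quadraticChar_ne_one hF)
  rw [(quadraticChar_isQuadratic F).inv, jacobiSum] at hJ
  rw [← Equiv.sum_comp (Equiv.mulLeft₀ (-c) (neg_ne_zero.mpr hc))]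
  have key (y : F) : quadraticChar F (-c * y) * quadraticChar F (-c * y + c) =
      quadraticChar F (-1) * (quadraticChar F y * quadraticChar F (1 - y)) := by
    rw [show -c * y + c = c * (1 - y) by ring, show -c * y = -1 * (c * y) by ring]
    simp only [map_mul]
    linear_combination quadraticChar F (-1) * quadraticChar F y * quadraticChar F (1 - y) *
      quadraticChar_sq_one hc
  simp only [Equiv.mulLeft₀_apply, key, ← Finset.mul_sum, hJ]
  linear_combination -quadraticChar_sq_one (neg_ne_zero.mpr (one_ne_zero (α := F)))

/-- The sum of the squares of the quadratic character of a finite field `F` is `#F - 1`. -/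
theorem sum_quadraticChar_sq (F : Type*) [Field F] [Fintype F] [DecidableEq F] :
    ∑ x : F, quadraticChar F x * quadraticChar F x = Fintype.card F - 1 := by
  have key (x : F) : quadraticChar F x * quadraticChar F x = 1 - if x = 0 then 1 else 0 := by
    split_ifs with h
    · simp [h]
    · simpa [sq] using quadraticChar_sq_one h
  simp [key, -quadraticChar_apply]

/-- Lemma 7 (Paley): for a prime `l ≡ 3 (mod 4)`, the Paley matrix `W` of order
`n = l + 1`, indexed by the projective line `{∞} ∪ ℤ/lℤ`, is a skew-symmetric conference
matrix: zero diagonal, off-diagonal entries `±1`, `Wᵀ = -W` and `W·Wᵀ = l·I = (n-1)·I`. -/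
theorem stmt_12 (l : ℕ) [Fact (Nat.Prime l)] (hl : l % 4 = 3)
    (n : ℕ) (hn : n = l + 1)
    (W : Matrix (Option (ZMod l)) (Option (ZMod l)) ℤ)
    (hW1 : W none none = 0)
    (hW2 : ∀ j : ZMod l, W none (some j) = 1)
    (hW3 : ∀ j : ZMod l, W (some j) none = -1)
    (hW4 : ∀ i j : ZMod l, W (some i) (some j) = legendreSym l ((j - i).val)) :
    (∀ i, W i i = 0) ∧
    (∀ i j, i ≠ j → W i j = 1 ∨ W i j = -1) ∧
    Wᵀ = -W ∧
    W * Wᵀ = ((n : ℤ) - 1) • 1 := by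
  have hF : ringChar (ZMod l) ≠ 2 := by
    rw [ZMod.ringChar_zmod_n]
    omega
  have hW (i j : ZMod l) : W (some i) (some j) = quadraticChar (ZMod l) (j - i) := by
    simp [hW4, legendreSym]
  have hneg : quadraticChar (ZMod l) (-1) = -1 := by
    rw [quadraticChar_neg_one hF, ZMod.card, ZMod.χ₄_nat_three_mod_four hl]
  refine ⟨?_, ?_, ?_, ?_⟩
  · rintro (_ | i)
    · exact hW1
    · simp [hW]
  · rintro (_ | i) (_ | j) hij
    · exact absurd rfl hij
    · exact Or.inl (hW2 j)
    · exact Or.inr (hW3 i)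
    · rw [hW]
      exact quadraticChar_dichotomy (sub_ne_zero.mpr fun h => hij (h ▸ rfl))
  · ext (_ | i) (_ | j)
    · simp [hW1]
    · simp [hW2, hW3]
    · simp [hW2, hW3]
    · simp only [transpose_apply, neg_apply, hW]
      rw [← neg_sub j i, neg_eq_neg_one_mul (j - i), map_mul, hneg, neg_one_mul]
  · have hsum (k : ZMod l) : ∑ j, quadraticChar (ZMod l) (j - k) = 0 :=
      (Equiv.sum_comp (Equiv.subRight k) (quadraticChar (ZMod l))).trans
        (quadraticChar_sum_zero hF)
    have hcorr (i k : ZMod l) :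
        ∑ j, quadraticChar (ZMod l) (j - i) * quadraticChar (ZMod l) (j - k) =
          ∑ x, quadraticChar (ZMod l) x * quadraticChar (ZMod l) (x + (i - k)) :=
      Fintype.sum_equiv (Equiv.subRight i) _ _ fun j => by simp
    ext (_ | i) (_ | k)
    · simp [mul_apply, Fintype.sum_option, hW1, hW2, hn]
    · simp [mul_apply, Fintype.sum_option, hW1, hW2, hW, hsum, -quadraticChar_apply]
    · simp [mul_apply, Fintype.sum_option, hW1, hW2, hW, hsum, -quadraticChar_apply]
    · simp only [mul_apply, transpose_apply, Fintype.sum_option, hW3, hW, hcorr, Matrix.smul_apply]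
      obtain rfl | hik := eq_or_ne i k
      · simp [sum_quadraticChar_sq, hn, -quadraticChar_apply]
      · rw [sum_quadraticChar_mul_quadraticChar_add hF (sub_ne_zero.mpr hik)]
        simp [hik]
end

section
/- Let r ≥ 1 and let t be an integer with t ≡ 1 (mod 4) and t² ≡ −l (mod 2^(r+2)). Then 𝓟^r = 2^r·ℤ + ((t+s)/2)·ℤ and 𝓠^r = 2^r·ℤ + ((t−s)/2)·ℤ; that is, as an additive group, the r-th power of 𝓟 (resp. 𝓠) is exactly the set of ℤ-linear combinations of 2^r and (t+s)/2 (resp. 2^r and (t−s)/2) inside 𝓞. -/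
open NumberField

section QuadraticField

variable {K : Type*} [Field K] [NumberField K]

/-- In a number field, a rational number that is integral over `ℤ` is an integer. -/
theorem exists_int_of_isIntegral_ratCast {c : ℚ} (h : IsIntegral ℤ (c : K)) :
    ∃ m : ℤ, c = m := by
  have h' : IsIntegral ℤ c := by
    refine (isIntegral_algebraMap_iff (A := ℚ) (B := K) (algebraMap ℚ K).injective).1 ?_
    simpa using h
  obtain ⟨m, hm⟩ := IsIntegrallyClosed.isIntegral_iff.1 h'
  exact ⟨m, by simpa using hm.symm⟩

/-- If `l` is squarefree and `l * c ^ 2` is an integer for a rational `c`, then `c` is an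
integer. -/
theorem exists_int_of_squarefree_mul_sq {l : ℕ} (hl : Squarefree l) {c : ℚ} {k : ℤ}
    (h : (l : ℚ) * c ^ 2 = k) : ∃ n : ℤ, c = n := by
  have hd : (c.den : ℚ) ≠ 0 := by exact_mod_cast c.den_nz
  have h1 : (l : ℤ) * c.num ^ 2 = k * (c.den : ℤ) ^ 2 := by
    have h2 : (l : ℚ) * c.num ^ 2 = k * (c.den : ℚ) ^ 2 := by
      rw [← h]
      nth_rewrite 2 [← Rat.num_div_den c]
      field_simp
    exact_mod_cast h2
  have hcop : IsCoprime ((c.den : ℤ) ^ 2) (c.num ^ 2) := by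
    apply IsCoprime.pow
    rw [Int.isCoprime_iff_gcd_eq_one, Int.gcd_comm]
    simpa [Int.gcd] using c.reduced
  have h2 : ((c.den : ℤ) ^ 2) ∣ (l : ℤ) :=
    hcop.dvd_of_dvd_mul_right ⟨k, by rw [h1]; ring⟩
  have h3 : c.den * c.den ∣ l := by
    rw [← pow_two]
    exact_mod_cast h2
  have h4 : c.den = 1 := Nat.isUnit_iff.1 (hl _ h3)
  exact ⟨c.num, ((Rat.den_eq_one_iff c).1 h4).symm⟩

theorem linearIndependent_one_sqrt {l : ℕ} (hl0 : 0 < l) {s : K} (hs : s ^ 2 = -(l : K)) :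
    LinearIndependent ℚ ![(1 : K), s] := by
  rw [LinearIndependent.pair_iff]
  intro c d h
  have h0 : (c : K) = -((d : K) * s) := by
    simp only [Algebra.smul_def, eq_ratCast, mul_one] at h
    linear_combination h
  have h1 : (c : K) ^ 2 + l * (d : K) ^ 2 = 0 := by
    rw [h0]; linear_combination (d : K) ^ 2 * hs
  have h2 : c ^ 2 + l * d ^ 2 = 0 := by exact_mod_cast h1
  have hl : (0 : ℚ) < l := by exact_mod_cast hl0
  have hd : d = 0 := by
    by_contra hd
    have : 0 < d ^ 2 := by positivity
    nlinarith [sq_nonneg c, mul_pos hl this]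
  subst hd
  exact ⟨by simpa using h2, rfl⟩

/-- In the quadratic field `ℚ(√-l)` every element is `a + b√-l` with `2a` its trace. -/
theorem exists_eq_add_mul_sqrt {l : ℕ} (hl0 : 0 < l) (hdeg : Module.finrank ℚ K = 2)
    {s : K} (hs : s ^ 2 = -(l : K)) (x : K) :
    ∃ a b : ℚ, x = a + b * s ∧ Algebra.trace ℚ K x = 2 * a := by
  obtain ⟨B, hB⟩ : ∃ B : Module.Basis (Fin 2) ℚ K, ⇑B = ![(1 : K), s] :=
    ⟨basisOfLinearIndependentOfCardEqFinrank (linearIndependent_one_sqrt hl0 hs)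
      (by rw [hdeg, Fintype.card_fin]), coe_basisOfLinearIndependentOfCardEqFinrank _ _⟩
  have hB0 : B 0 = 1 := by rw [hB]; rfl
  have hB1 : B 1 = s := by rw [hB]; rfl
  have hss : s * s = (-(l : ℚ)) • B 0 := by
    rw [hB0, ← pow_two, hs, Algebra.smul_def]; simp
  have hts : Algebra.trace ℚ K s = 0 := by
    rw [Algebra.trace_eq_matrix_trace B, Matrix.trace_fin_two]
    simp only [Algebra.leftMulMatrix_eq_repr_mul]
    rw [hB1, hss, hB0, mul_one, ← hB0, ← hB1]
    simp only [map_smul, Finsupp.smul_apply, Module.Basis.repr_self]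
    simp
  have hx := B.sum_repr x
  rw [Fin.sum_univ_two, hB0, hB1] at hx
  refine ⟨B.repr x 0, B.repr x 1, ?_, ?_⟩
  · nth_rewrite 1 [← hx]
    simp [Algebra.smul_def]
  · nth_rewrite 1 [← hx]
    rw [map_add, map_smul, map_smul, hts, ← map_one (algebraMap ℚ K), Algebra.trace_algebraMap,
      hdeg]
    simp [mul_comm]

/-- `1` and `(1 + √-l) / 2` generate the ring of integers of `ℚ(√-l)` over `ℤ`. -/
theorem exists_int_add_int_mul {l : ℕ} (hl0 : 0 < l) (hsf : Squarefree l)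
    (hdeg : Module.finrank ℚ K = 2) {s : K} (hs : s ^ 2 = -(l : K))
    {σ : 𝓞 K} (hσ : algebraMap (𝓞 K) K σ = (1 + s) / 2) (x : 𝓞 K) :
    ∃ m n : ℤ, x = m + n * σ := by
  obtain ⟨a, b, hx, htr⟩ := exists_eq_add_mul_sqrt hl0 hdeg hs (algebraMap (𝓞 K) K x)
  obtain ⟨m, hm⟩ : ∃ m : ℤ, 2 * a = m := by
    have h := Algebra.isIntegral_trace (L := ℚ) x.isIntegral_coe
    obtain ⟨m, hm⟩ := IsIntegrallyClosed.isIntegral_iff.1 h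
    exact ⟨m, by rw [← htr, ← hm]; simp⟩
  have hmK : 2 * (a : K) = m := by exact_mod_cast congrArg (Rat.cast : ℚ → K) hm
  obtain ⟨k, hk⟩ : ∃ k : ℤ, (l : ℚ) * (2 * b) ^ 2 = k := by
    refine exists_int_of_isIntegral_ratCast (K := K) ?_
    have h : algebraMap (𝓞 K) K (-(2 * x - (m : 𝓞 K)) ^ 2) = (((l : ℚ) * (2 * b) ^ 2 : ℚ) : K) := by
      simp only [map_sub, map_mul, map_neg, map_pow, map_intCast, map_ofNat]
      rw [hx, ← hmK]
      push_cast
      linear_combination (-4 * (b : K) ^ 2) * hs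
    rw [← h]
    exact RingOfIntegers.isIntegral_coe _
  obtain ⟨n, hn⟩ := exists_int_of_squarefree_mul_sq hsf hk
  have hnK : 2 * (b : K) = n := by exact_mod_cast congrArg (Rat.cast : ℚ → K) hn
  obtain ⟨j, hj⟩ : ∃ j : ℤ, a - b = j := by
    refine exists_int_of_isIntegral_ratCast (K := K) ?_
    have h : algebraMap (𝓞 K) K (x - (n : 𝓞 K) * σ) = ((a - b : ℚ) : K) := by
      simp only [map_sub, map_mul, map_intCast]
      rw [hx, hσ, ← hnK]
      push_cast
      ring
    rw [← h]
    exact RingOfIntegers.isIntegral_coe _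
  have hjK : (a : K) - b = j := by exact_mod_cast congrArg (Rat.cast : ℚ → K) hj
  refine ⟨j, n, RingOfIntegers.coe_injective ?_⟩
  simp only [map_add, map_mul, map_intCast]
  rw [hx, hσ, ← hjK, ← hnK]
  ring

end QuadraticField

/-- If `p * q` is divisible by `2 ^ r` and `p + q` is an odd integer, then `(2, p) ^ r = (2 ^ r, p)`
as ideals. -/
theorem span_two_pair_pow {R : Type*} [CommRing R] {p q c : R} {t : ℤ} {r : ℕ} (hr : 1 ≤ r)
    (ht : Odd t) (hadd : p + q = t) (hmul : p * q = 2 ^ r * c) :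
    Ideal.span {2, p} ^ r = Ideal.span {2 ^ r, p} := by
  apply le_antisymm
  · clear hr hmul
    induction r with
    | zero => simp [Ideal.eq_top_of_unit_mem _ 1 1 (Ideal.subset_span (Set.mem_insert 1 {p}))]
    | succ k ih =>
      rw [pow_succ]
      refine (Ideal.mul_mono_left ih).trans ?_
      rw [Ideal.span_mul_span', Ideal.span_le]
      rintro _ ⟨x, hx, y, hy, rfl⟩
      simp only [Set.mem_insert_iff, Set.mem_singleton_iff] at hx hy
      simp only [SetLike.mem_coe, Ideal.mem_span_pair]
      rcases hx with rfl | rfl <;> rcases hy with rfl | rfl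
      · exact ⟨1, 0, by ring⟩
      · exact ⟨0, 2 ^ k, by ring⟩
      · exact ⟨0, 2, by ring⟩
      · exact ⟨0, y, by ring⟩
  · set I := Ideal.span {2, p} ^ r with hI
    have h2 : (2 : R) ^ r ∈ I := Ideal.pow_mem_pow (Ideal.subset_span (by simp)) r
    have hpr : p ^ r ∈ I := Ideal.pow_mem_pow (Ideal.subset_span (by simp)) r
    have hstep : ∀ j, (t : R) ^ j * p - p ^ (j + 1) ∈ I := by
      intro j
      induction j with
      | zero => simp
      | succ j ih =>
        have : (t : R) ^ (j + 1) * p - p ^ (j + 1 + 1)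
            = t * ((t : R) ^ j * p - p ^ (j + 1)) + (p ^ j * c) * 2 ^ r := by
          linear_combination (-p ^ (j + 1)) * hadd + p ^ j * hmul
        rw [this]
        exact I.add_mem (I.mul_mem_left _ ih) (I.mul_mem_left _ h2)
    have htp : (t : R) ^ (r - 1) * p ∈ I := by
      have h := hstep (r - 1)
      rw [Nat.sub_add_cancel hr] at h
      simpa using I.add_mem h hpr
    obtain ⟨u, v, huv⟩ : IsCoprime (t ^ (r - 1)) ((2 : ℤ) ^ r) :=
      (Int.isCoprime_two_right.2 ht).pow
    have huv' : (u : R) * t ^ (r - 1) + v * 2 ^ r = 1 := by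
      exact_mod_cast congrArg (Int.cast : ℤ → R) huv
    have hp : p ∈ I := by
      have : p = u * ((t : R) ^ (r - 1) * p) + (v * p) * 2 ^ r := by
        linear_combination (-p) * huv'
      rw [this]
      exact I.add_mem (I.mul_mem_left _ htp) (I.mul_mem_left _ h2)
    rw [Ideal.span_le]
    rintro _ (rfl | rfl)
    exacts [h2, hp]

theorem mem_span_pow_iff {l : ℕ} (hl0 : 0 < l) (hsf : Squarefree l)
    {K : Type*} [Field K] [NumberField K] (hdeg : Module.finrank ℚ K = 2)
    {s : K} (hs : s ^ 2 = -(l : K)) {σ : 𝓞 K} (hσ : algebraMap (𝓞 K) K σ = (1 + s) / 2)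
    {r : ℕ} (hr : 1 ≤ r) {t : ℤ} (ht1 : (4 : ℤ) ∣ t - 1)
    (ht2 : (2 ^ (r + 2) : ℤ) ∣ t ^ 2 + l) {p : 𝓞 K} (hp : algebraMap (𝓞 K) K p = ((t : K) + s) / 2)
    (x : 𝓞 K) :
    x ∈ Ideal.span {2, σ} ^ r ↔ ∃ a b : ℤ, x = a • (2 ^ r : 𝓞 K) + b • p := by
  obtain ⟨w, hw⟩ := ht1
  obtain ⟨c, hc⟩ := ht2
  obtain rfl : t = 4 * w + 1 := by linarith
  have hσp : p = σ + w * 2 := by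
    apply RingOfIntegers.coe_injective
    simp only [map_add, map_mul, map_intCast, map_ofNat]
    rw [hp, hσ]
    push_cast
    ring
  have hspan : Ideal.span {2, σ} = Ideal.span {2, p} := by
    rw [hσp, Ideal.span_pair_add_mul_left]
  have hmul : p * ((4 * w + 1 : ℤ) - p) = 2 ^ r * (c : 𝓞 K) := by
    apply RingOfIntegers.coe_injective
    have hcK : ((4 * w + 1 : ℤ) : K) ^ 2 + l = 2 ^ (r + 2) * c := by
      exact_mod_cast congrArg (Int.cast : ℤ → K) hc
    simp only [map_sub, map_mul, map_pow, map_intCast, map_ofNat]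
    rw [hp]
    push_cast at hcK ⊢
    linear_combination hcK / 4 - hs / 4
  rw [hspan, span_two_pair_pow hr ⟨2 * w, by ring⟩ (add_sub_cancel p _) hmul,
    Ideal.mem_span_pair]
  have hint : ∀ y : 𝓞 K, ∃ m n : ℤ, y = m + n * p := fun y ↦ by
    obtain ⟨m, n, h⟩ := exists_int_add_int_mul hl0 hsf hdeg hs hσ y
    refine ⟨m - n * (w * 2), n, ?_⟩
    rw [h, hσp]
    push_cast
    ring
  simp only [zsmul_eq_mul]
  constructor
  · rintro ⟨y, z, rfl⟩
    obtain ⟨m, n, rfl⟩ := hint y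
    obtain ⟨m', n', rfl⟩ := hint z
    refine ⟨m - n' * c, n * 2 ^ r + m' + n' * (4 * w + 1), ?_⟩
    push_cast at hmul ⊢
    linear_combination (-n' : 𝓞 K) * hmul
  · rintro ⟨a, b, rfl⟩
    exact ⟨a, b, rfl⟩

/-- Lemma 8: for `r ≥ 1` and `t ≡ 1 (mod 4)` with `t² ≡ -l (mod 2^(r+2))`, one has
`𝓟^r = 2^r·ℤ + ((t+s)/2)·ℤ` and `𝓠^r = 2^r·ℤ + ((t-s)/2)·ℤ` as additive subgroups of
the ring of integers `𝓞` of `ℚ(√-l)`. -/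
theorem stmt_13 (l : ℕ) (hl0 : 0 < l) (hsf : Squarefree l) (hl7 : l % 8 = 7)
    (K : Type*) [Field K] [NumberField K] (hdeg : Module.finrank ℚ K = 2)
    (s : K) (hs : s ^ 2 = -(l : K))
    (σ τ : 𝓞 K) (hσ : (σ : K) = (1 + s) / 2) (hτ : (τ : K) = (1 - s) / 2)
    (P Q : Ideal (𝓞 K))
    (hP : P = Ideal.span {2, σ}) (hQ : Q = Ideal.span {2, τ})
    (r : ℕ) (hr : 1 ≤ r)
    (t : ℤ) (ht1 : (4 : ℤ) ∣ t - 1) (ht2 : (2 ^ (r + 2) : ℤ) ∣ t ^ 2 + l)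
    (p q : 𝓞 K) (hp : (p : K) = ((t : K) + s) / 2) (hq : (q : K) = ((t : K) - s) / 2) :
    (∀ x : 𝓞 K, x ∈ P ^ r ↔ ∃ a b : ℤ, x = a • (2 ^ r : 𝓞 K) + b • p) ∧
    (∀ x : 𝓞 K, x ∈ Q ^ r ↔ ∃ a b : ℤ, x = a • (2 ^ r : 𝓞 K) + b • q) := by
  subst hP hQ
  refine ⟨mem_span_pow_iff hl0 hsf hdeg hs hσ hr ht1 ht2 hp, ?_⟩
  exact mem_span_pow_iff hl0 hsf hdeg (s := -s) (by rw [neg_sq, hs])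
    (hτ.trans (by rw [sub_eq_add_neg])) hr ht1 ht2 (hq.trans (by rw [sub_eq_add_neg]))
end

section
/- Let l ≡ 7 (mod 8) be prime and let ζ be a primitive l-th root of unity in a field F of characteristic 2. Then the two sums σ₊ = Σ_{j : (j/l)=1} ζ^j and σ₋ = Σ_{j : (j/l)=−1} ζ^j are equal to 0 and 1 in some order. Moreover, if ζ is chosen so that σ₊ = 0, then for every integer a not divisible by l: Σ_{j : (j/l)=1} ζ^(a·j) = 0 if and only if a is a quadratic residue modulo l. -/
open Finset

theorem sum_filter_Ico_legendreSym_eq {M : Type*} [AddCommMonoid M] (l : ℕ) [Fact l.Prime]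
    {ε : ℤ} (hε : ε ≠ 0) (f : ZMod l → M) :
    ∑ j ∈ (Finset.Ico 1 l).filter (fun j : ℕ => legendreSym l (j : ℤ) = ε), f (j : ZMod l) =
      ∑ x with quadraticChar (ZMod l) x = ε, f x := by
  refine Finset.sum_nbij' (fun j : ℕ => (j : ZMod l)) ZMod.val ?_ ?_ ?_ ?_ ?_
  · intro j hj
    simpa [legendreSym] using (Finset.mem_filter.1 hj).2
  · intro x hx
    have hx := (Finset.mem_filter.1 hx).2
    have hx0 : x ≠ 0 := by
      rintro rfl
      exact hε (by simpa using hx.symm)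
    have hpos : 0 < x.val := Nat.pos_of_ne_zero (by simpa [ZMod.val_eq_zero] using hx0)
    exact Finset.mem_filter.2 ⟨Finset.mem_Ico.2 ⟨hpos, ZMod.val_lt x⟩, by
      rwa [legendreSym, Int.cast_natCast, ZMod.natCast_zmod_val]⟩
  · intro j hj
    exact ZMod.val_cast_of_lt (Finset.mem_Ico.1 (Finset.mem_filter.1 hj).1).2
  · intro x _
    exact ZMod.natCast_rightInverse x
  · intro j _
    rfl

theorem sum_quadraticChar_eq_comp_mul {K M : Type*} [Field K] [Fintype K] [DecidableEq K]
    [AddCommMonoid M] {b : K} (hb : b ≠ 0) (ε : ℤ) (f : K → M) :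
    ∑ x with quadraticChar K x = ε, f (b * x) =
      ∑ x with quadraticChar K x = quadraticChar K b * ε, f x := by
  have hsq : quadraticChar K b * quadraticChar K b = 1 := by
    rw [← sq, quadraticChar_sq_one hb]
  refine Finset.sum_nbij' (fun x => b * x) (fun x => b⁻¹ * x) ?_ ?_ ?_ ?_ ?_
  · intro x hx
    have hx := (Finset.mem_filter.1 hx).2
    exact Finset.mem_filter.2 ⟨Finset.mem_univ _, by rw [map_mul, hx]⟩
  · intro x hx
    have hx := (Finset.mem_filter.1 hx).2
    have h : quadraticChar K b * quadraticChar K (b⁻¹ * x) = quadraticChar K x := by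
      rw [← map_mul, mul_inv_cancel_left₀ hb]
    simp only [Finset.mem_filter, Finset.mem_univ, true_and]
    linear_combination quadraticChar K b * h + quadraticChar K b * hx +
      (ε - quadraticChar K (b⁻¹ * x)) * hsq
  · intro x _
    exact inv_mul_cancel_left₀ hb x
  · intro x _
    exact mul_inv_cancel_left₀ hb x
  · intro x _
    rfl

theorem quadraticChar_two_of_mod_eight_eq_seven {l : ℕ} [Fact l.Prime] (hl7 : l % 8 = 7) :
    quadraticChar (ZMod l) 2 = 1 := by
  have h := legendreSym.at_two (p := l) (by rintro rfl; omega)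
  rw [ZMod.χ₈_nat_eq_if_mod_eight, if_neg (by omega), if_pos (Or.inr hl7)] at h
  simpa [legendreSym] using h

theorem sum_quadraticChar_addChar_eq_zero_or_one {l : ℕ} [Fact l.Prime] (hl7 : l % 8 = 7)
    {F : Type*} [Field F] [CharP F 2] (ψ : AddChar (ZMod l) F) (ε : ℤ) :
    ∑ x with quadraticChar (ZMod l) x = ε, ψ x = 0 ∨
      ∑ x with quadraticChar (ZMod l) x = ε, ψ x = 1 := by
  have hχ := quadraticChar_two_of_mod_eight_eq_seven hl7
  have h2 : (2 : ZMod l) ≠ 0 := by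
    intro h
    simp [h] at hχ
  have h := sum_quadraticChar_eq_comp_mul h2 ε ψ
  simp only [hχ, one_mul, two_mul, AddChar.map_add_eq_mul, ← sq] at h
  rw [← CharTwo.sum_sq] at h
  have h' := sub_eq_zero.2 h
  rw [sq, ← mul_sub_one, mul_eq_zero, sub_eq_zero] at h'
  exact h'

theorem sum_quadraticChar_addChar_add {l : ℕ} [Fact l.Prime]
    {F : Type*} [Field F] [CharP F 2] {ψ : AddChar (ZMod l) F} (hψ : ψ ≠ 1) :
    ∑ x with quadraticChar (ZMod l) x = 1, ψ x +
      ∑ x with quadraticChar (ZMod l) x = -1, ψ x = 1 := by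
  have hdisj : Disjoint ({x | quadraticChar (ZMod l) x = 1} : Finset (ZMod l))
      ({x | quadraticChar (ZMod l) x = -1} : Finset (ZMod l)) := by
    refine Finset.disjoint_filter.2 fun x _ h h' => ?_
    omega
  have hset : ({x | quadraticChar (ZMod l) x = 1} : Finset (ZMod l)) ∪
      ({x | quadraticChar (ZMod l) x = -1} : Finset (ZMod l)) = Finset.univ.erase 0 := by
    ext x
    simp only [Finset.mem_union, Finset.mem_filter, Finset.mem_univ, true_and, Finset.mem_erase,
      and_true]
    refine ⟨?_, quadraticChar_dichotomy⟩
    rintro h rfl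
    simp at h
  rw [← Finset.sum_union hdisj, hset]
  have h := Finset.add_sum_erase Finset.univ (fun x => ψ x) (Finset.mem_univ 0)
  rw [AddChar.sum_eq_zero_of_ne_one hψ, AddChar.map_zero_eq_one] at h
  exact (CharTwo.add_eq_zero.1 h).symm

/-- For a prime `l ≡ 7 (mod 8)` and a primitive `l`-th root of unity `ζ` in a field of
characteristic 2, the sums `σ₊ = Σ_{(j/l)=1} ζ^j` and `σ₋ = Σ_{(j/l)=-1} ζ^j` equal `0`
and `1` in some order; and if `ζ` is chosen with `σ₊ = 0`, then for any integer `a` not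
divisible by `l`, `Σ_{(j/l)=1} ζ^(a·j) = 0` iff `a` is a quadratic residue mod `l`. -/
theorem stmt_14 (l : ℕ) [Fact (Nat.Prime l)] (hl7 : l % 8 = 7)
    (F : Type*) [Field F] [CharP F 2]
    (ζ : F) (hζ : orderOf ζ = l) :
    (((∑ j ∈ (Finset.Ico 1 l).filter (fun j : ℕ => legendreSym l (j : ℤ) = 1), ζ ^ j) = 0 ∧
      (∑ j ∈ (Finset.Ico 1 l).filter (fun j : ℕ => legendreSym l (j : ℤ) = -1), ζ ^ j) = 1) ∨
     ((∑ j ∈ (Finset.Ico 1 l).filter (fun j : ℕ => legendreSym l (j : ℤ) = 1), ζ ^ j) = 1 ∧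
      (∑ j ∈ (Finset.Ico 1 l).filter (fun j : ℕ => legendreSym l (j : ℤ) = -1), ζ ^ j) = 0)) ∧
    ((∑ j ∈ (Finset.Ico 1 l).filter (fun j : ℕ => legendreSym l (j : ℤ) = 1), ζ ^ j) = 0 →
      ∀ a : ℤ, ¬ ((l : ℤ) ∣ a) →
        ((∑ j ∈ (Finset.Ico 1 l).filter (fun j : ℕ => legendreSym l (j : ℤ) = 1),
            ζ ^ (a * j : ℤ)) = 0 ↔ legendreSym l a = 1)) := by
  have hζl : ζ ^ l = 1 := by rw [← hζ, pow_orderOf_eq_one]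
  set ψ : AddChar (ZMod l) F := AddChar.zmodChar l hζl
  have hψnat (j : ℕ) : ψ (j : ZMod l) = ζ ^ j := AddChar.zmodChar_apply' hζl j
  have hψ : ψ ≠ 1 := by
    intro h
    have h1 := hψnat 1
    rw [h, pow_one, AddChar.one_apply] at h1
    rw [← h1, orderOf_one] at hζ
    omega
  have hψint (a : ℤ) (j : ℕ) : ζ ^ (a * j : ℤ) = ψ ((a : ZMod l) * (j : ZMod l)) := by
    rw [← zsmul_eq_mul, AddChar.map_zsmul_eq_zpow, hψnat, ← zpow_natCast, ← zpow_mul, mul_comm]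
  simp only [hψint, ← hψnat]
  rw [sum_filter_Ico_legendreSym_eq l one_ne_zero ψ,
    sum_filter_Ico_legendreSym_eq l (by norm_num) ψ]
  have hadd := sum_quadraticChar_addChar_add hψ
  refine ⟨?_, fun h0 a ha => ?_⟩
  · rcases sum_quadraticChar_addChar_eq_zero_or_one hl7 ψ 1 with h | h
    · exact Or.inl ⟨h, by rwa [h, zero_add] at hadd⟩
    · exact Or.inr ⟨h, by rwa [h, add_eq_left] at hadd⟩
  · have ha0 : (a : ZMod l) ≠ 0 := by rwa [Ne, ZMod.intCast_zmod_eq_zero_iff_dvd]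
    rw [sum_filter_Ico_legendreSym_eq l one_ne_zero (fun x => ψ ((a : ZMod l) * x)),
      sum_quadraticChar_eq_comp_mul ha0 1 ψ, mul_one, legendreSym]
    rw [h0, zero_add] at hadd
    rcases quadraticChar_dichotomy ha0 with h | h
    · simp only [h, h0]
    · rw [h, hadd]
      norm_num
end

section
/- In the quotient ring 𝔽₂[X]/(X^l − 1), the ideal generated by the images of g(X) = Σ_{j=0}^{l−1} X^j and h(X) = Σ_{j : (j/l)=1} X^j equals the principal ideal generated by the image of f₊ (regarded as a polynomial over 𝔽₂). In other words, the binary cyclic code generated by the all-ones word and the cyclic shifts of the quadratic-residue indicator word is the quadratic residue code with generator polynomial f₊. -/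
open Finset Polynomial

/-- A sum over the naturals in `[1, l)` with Legendre symbol `1` as a sum over residue classes. -/
lemma sum_legendreSym_eq_one (l : ℕ) [Fact (Nat.Prime l)] {M : Type*} [AddCommMonoid M]
    (f : ℕ → M) :
    ∑ j ∈ (Finset.Ico 1 l).filter (fun j : ℕ => legendreSym l (j : ℤ) = 1), f j =
      ∑ a : ZMod l with quadraticChar (ZMod l) a = 1, f a.val := by
  have hl : l.Prime := Fact.out
  refine Finset.sum_bij' (fun j _ => (j : ZMod l)) (fun a _ => a.val) ?_ ?_ ?_ ?_ ?_
  · intro j hj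
    simp only [Finset.mem_filter, Finset.mem_univ, true_and] at hj ⊢
    simpa [legendreSym] using hj.2
  · intro a ha
    simp only [Finset.mem_filter, Finset.mem_univ, true_and, Finset.mem_Ico] at ha ⊢
    refine ⟨⟨?_, ZMod.val_lt a⟩, by simpa [legendreSym] using ha⟩
    rw [Nat.one_le_iff_ne_zero, Ne, ZMod.val_eq_zero]
    rintro rfl
    simp at ha
  · intro j hj
    simp only [Finset.mem_filter, Finset.mem_Ico] at hj
    exact ZMod.val_cast_of_lt hj.1.2
  · intro a _
    simp
  · intro j hj
    simp only [Finset.mem_filter, Finset.mem_Ico] at hj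
    simp [ZMod.val_cast_of_lt hj.1.2]

/-- Raising the terms of a sum over a quadratic character class to the power `m` permutes
the classes. -/
lemma sum_pow_mul_quadraticChar (l : ℕ) [Fact (Nat.Prime l)] {F : Type*} [Field F] {ζ : F}
    (hζ : ζ ^ l = 1) {m : ZMod l} (hm : m ≠ 0) (c : ℤ) :
    ∑ a : ZMod l with quadraticChar (ZMod l) a = c, (ζ ^ m.val) ^ a.val =
      ∑ a : ZMod l with quadraticChar (ZMod l) a = quadraticChar (ZMod l) m * c,
        ζ ^ a.val := by
  have hχ : quadraticChar (ZMod l) m ≠ 0 := by rwa [Ne, quadraticChar_eq_zero_iff]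
  refine Finset.sum_equiv (Equiv.mulLeft₀ m hm) ?_ ?_
  · intro a
    simp only [Finset.mem_filter, Finset.mem_univ, true_and, Equiv.mulLeft₀_apply, map_mul]
    exact (mul_right_inj' hχ).symm
  · intro a _
    simp only [Equiv.mulLeft₀_apply]
    rw [← pow_mul, ZMod.val_mul, ← pow_mod_orderOf ζ (m.val * a.val),
      ← pow_mod_orderOf ζ (m.val * a.val % l),
      Nat.mod_mod_of_dvd _ (orderOf_dvd_of_pow_eq_one hζ)]

/-- A sum over residue classes splits into the contributions of `0`, of the residues and of the
nonresidues. -/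
lemma sum_eq_add_sum_quadraticChar (l : ℕ) [Fact (Nat.Prime l)] {M : Type*}
    [AddCommMonoid M] (f : ZMod l → M) :
    ∑ a, f a = f 0 + (∑ a : ZMod l with quadraticChar (ZMod l) a = 1, f a +
      ∑ a : ZMod l with quadraticChar (ZMod l) a = -1, f a) := by
  have hsplit : (univ : Finset (ZMod l)) =
      insert 0 (univ.filter (fun a => quadraticChar (ZMod l) a = 1) ∪
        univ.filter (fun a => quadraticChar (ZMod l) a = -1)) := by
    ext a
    by_cases ha : a = 0
    · simp [ha]
    · simpa only [Finset.mem_univ, Finset.mem_insert, ha, Finset.mem_union, Finset.mem_filter,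
        true_and, false_or, true_iff] using quadraticChar_dichotomy ha
  rw [hsplit, Finset.sum_insert (by simp), Finset.sum_union]
  · rw [← hsplit]
  · rw [Finset.disjoint_left]
    intro a ha hb
    simp only [Finset.mem_filter] at ha hb
    have := ha.2.symm.trans hb.2
    norm_num at this

lemma two_mul_card_quadraticChar_eq_one (l : ℕ) [Fact (Nat.Prime l)] (hl : l ≠ 2) :
    2 * #{a : ZMod l | quadraticChar (ZMod l) a = 1} + 1 = l := by
  have h0 := quadraticChar_sum_zero (F := ZMod l) (by rwa [ZMod.ringChar_zmod_n])
  have h1 := sum_eq_add_sum_quadraticChar l (fun _ => 1)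
  rw [sum_eq_add_sum_quadraticChar l,
    Finset.sum_congr rfl (fun a ha => (Finset.mem_filter.1 ha).2),
    Finset.sum_congr (s₁ := univ.filter fun a => quadraticChar (ZMod l) a = -1) rfl
      (fun a ha => (Finset.mem_filter.1 ha).2)] at h0
  simp only [MulChar.map_zero, Finset.sum_const, smul_eq_mul, nsmul_eq_mul, mul_one, mul_neg,
    zero_add, Finset.card_univ, ZMod.card] at h0 h1
  omega

lemma sum_pow_val_eq_zero (l : ℕ) [Fact (Nat.Prime l)] {F : Type*} [Field F] {ζ : F}
    (hζ : orderOf ζ = l) : ∑ a : ZMod l, ζ ^ a.val = 0 := by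
  have hl : l.Prime := Fact.out
  have : ∑ a : ZMod l, ζ ^ a.val = ∑ j ∈ Finset.range l, ζ ^ j := by
    refine Finset.sum_bij' (fun a _ => a.val) (fun j _ => (j : ZMod l)) ?_ ?_ ?_ ?_ ?_
    · intro a _
      simpa using ZMod.val_lt a
    · simp
    · simp
    · intro j hj
      exact ZMod.val_cast_of_lt (Finset.mem_range.1 hj)
    · simp
  rw [this]
  exact (hζ ▸ IsPrimitiveRoot.orderOf ζ : IsPrimitiveRoot ζ l).geom_sum_eq_zero hl.one_lt

/-- A product of distinct linear factors divides every polynomial vanishing at their roots. -/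
lemma prod_X_sub_C_dvd {ι F : Type*} [Field F] {s : Finset ι} {r : ι → F}
    (hr : Set.InjOn r s) {P : F[X]} (hP : ∀ i ∈ s, P.eval (r i) = 0) :
    ∏ i ∈ s, (X - C (r i)) ∣ P := by
  refine Finset.prod_dvd_of_coprime ?_ fun i hi => dvd_iff_isRoot.2 (hP i hi)
  intro i hi j hj hij
  exact isCoprime_X_sub_C_of_isUnit_sub (sub_ne_zero.2 (hr.ne hi hj hij)).isUnit

lemma X_pow_sub_one_dvd {l : ℕ} (hl : 0 < l) {F : Type*} [Field F] {ζ : F}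
    (hζ : IsPrimitiveRoot ζ l) {P : F[X]} (hP : ∀ i < l, P.eval (ζ ^ i) = 0) :
    X ^ l - 1 ∣ P := by
  rw [X_pow_sub_one_eq_prod hl hζ]
  refine prod_X_sub_C_dvd (r := id) (Set.injOn_id _) fun x hx => ?_
  have : NeZero l := ⟨hl.ne'⟩
  obtain ⟨i, hi, rfl⟩ := hζ.eq_pow_of_pow_eq_one ((mem_nthRootsFinset hl _).1 hx)
  exact hP i hi

/-- The quadratic residue indicator polynomial takes the value `0` at `ζ ^ i` for `i` a quadratic
residue. -/
lemma sum_pow_quadraticChar_of_residue (l : ℕ) [Fact (Nat.Prime l)] {F : Type*} [Field F] {ζ : F}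
    (hζ : ζ ^ l = 1)
    (h0 : ∑ a : ZMod l with quadraticChar (ZMod l) a = 1, ζ ^ a.val = 0)
    {m : ZMod l} (hm : quadraticChar (ZMod l) m = 1) :
    ∑ a : ZMod l with quadraticChar (ZMod l) a = 1, (ζ ^ m.val) ^ a.val = 0 := by
  have hm0 : m ≠ 0 := by
    rintro rfl
    simp at hm
  rw [sum_pow_mul_quadraticChar l hζ hm0, hm, one_mul, h0]

/-- In characteristic two, for `l ≡ 3 (mod 4)`, the quadratic residue indicator polynomial takes
the value `1` at `ζ ^ i` for `i` not a nonzero quadratic residue. -/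
lemma sum_pow_quadraticChar_of_not_residue (l : ℕ) [Fact (Nat.Prime l)] (hl : l % 4 = 3)
    {F : Type*} [Field F] [CharP F 2] {ζ : F} (hζ : orderOf ζ = l)
    (h0 : ∑ a : ZMod l with quadraticChar (ZMod l) a = 1, ζ ^ a.val = 0)
    {m : ZMod l} (hm : quadraticChar (ZMod l) m ≠ 1) :
    ∑ a : ZMod l with quadraticChar (ZMod l) a = 1, (ζ ^ m.val) ^ a.val = 1 := by
  have hl2 : l ≠ 2 := by omega
  by_cases hm0 : m = 0
  · have hcard := two_mul_card_quadraticChar_eq_one l hl2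
    have hodd : Odd #{a : ZMod l | quadraticChar (ZMod l) a = 1} := by
      rw [Nat.odd_iff]
      omega
    simp only [hm0, ZMod.val_zero, pow_zero, one_pow, Finset.sum_const, nsmul_eq_mul, mul_one]
    obtain ⟨k, hk⟩ := hodd
    rw [hk]
    push_cast
    rw [CharTwo.two_eq_zero, zero_mul, zero_add]
  · have hm1 := (quadraticChar_dichotomy hm0).resolve_left hm
    have hsum := sum_pow_val_eq_zero l hζ
    rw [sum_eq_add_sum_quadraticChar l, h0, zero_add, ZMod.val_zero, pow_zero] at hsum
    rw [sum_pow_mul_quadraticChar l (hζ ▸ pow_orderOf_eq_one ζ) hm0, hm1, mul_one]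
    exact (CharTwo.add_eq_zero.1 hsum).symm

/-- Theorem (case `r = 1` of Theorem 9): in `𝔽₂[X]/(X^l - 1)`, the ideal generated by the
all-ones polynomial `g(X) = Σ_{j<l} X^j` and the quadratic-residue indicator polynomial
`h(X) = Σ_{(j/l)=1} X^j` is the principal ideal generated by `f₊`, i.e. the binary cyclic
code generated by the all-ones word and the shifts of the QR indicator word is the
quadratic residue code with generator polynomial `f₊`. -/
theorem stmt_15 (l : ℕ) [Fact (Nat.Prime l)] (hl7 : l % 8 = 7)
    (F : Type*) [Field F] [CharP F 2] (φ : ZMod 2 →+* F)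
    (ζ : F) (hζ : orderOf ζ = l)
    (hchoice : (∑ j ∈ (Finset.Ico 1 l).filter (fun j : ℕ => legendreSym l (j : ℤ) = 1),
      ζ ^ j) = 0)
    (fplus : Polynomial (ZMod 2))
    (hfp : fplus.map φ =
      ∏ j ∈ (Finset.Ico 1 l).filter (fun j : ℕ => legendreSym l (j : ℤ) = 1),
        (X - C (ζ ^ j))) :
    Ideal.span {Ideal.Quotient.mk (Ideal.span {(X : Polynomial (ZMod 2)) ^ l - 1})
        (∑ j ∈ Finset.range l, X ^ j),
      Ideal.Quotient.mk (Ideal.span {(X : Polynomial (ZMod 2)) ^ l - 1})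
        (∑ j ∈ (Finset.Ico 1 l).filter (fun j : ℕ => legendreSym l (j : ℤ) = 1), X ^ j)} =
    Ideal.span {Ideal.Quotient.mk (Ideal.span {(X : Polynomial (ZMod 2)) ^ l - 1})
        fplus} := by
  have hl : l.Prime := Fact.out
  have hprim : IsPrimitiveRoot ζ l := hζ ▸ IsPrimitiveRoot.orderOf ζ
  have hζl := hprim.pow_eq_one
  set g : (ZMod 2)[X] := ∑ j ∈ Finset.range l, X ^ j
  set h : (ZMod 2)[X] :=
    ∑ j ∈ (Finset.Ico 1 l).filter (fun j : ℕ => legendreSym l (j : ℤ) = 1), X ^ j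
  have hroot := hchoice
  rw [sum_legendreSym_eq_one] at hroot
  have heval (x : F) : (h.map φ).eval x =
      ∑ a : ZMod l with quadraticChar (ZMod l) a = 1, x ^ a.val := by
    simp [h, Polynomial.map_sum, eval_finsetSum,
      sum_legendreSym_eq_one l (fun j => x ^ j)]
  have hres (i : ℕ) (hi : i ∈ (Finset.Ico 1 l).filter
      (fun j : ℕ => legendreSym l (j : ℤ) = 1)) :
      i ≠ 0 ∧ i < l ∧ quadraticChar (ZMod l) (i : ZMod l) = 1 := by
    simp only [Finset.mem_filter, Finset.mem_Ico, legendreSym, Int.cast_natCast] at hi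
    exact ⟨by omega, hi.1.2, hi.2⟩
  have hinj : Set.InjOn (fun j : ℕ => ζ ^ j) ((Finset.Ico 1 l).filter
      (fun j : ℕ => legendreSym l (j : ℤ) = 1)) := fun i hi j hj hij =>
    hprim.pow_inj (hres i hi).2.1 (hres j hj).2.1 hij
  have hfh : fplus ∣ h := by
    rw [← Polynomial.map_dvd_map' φ, hfp]
    refine prod_X_sub_C_dvd hinj fun i hi => ?_
    obtain ⟨-, hil, hi1⟩ := hres i hi
    rw [heval]
    simpa only [ZMod.val_cast_of_lt hil] using
      sum_pow_quadraticChar_of_residue l hζl hroot hi1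
  have hfg : fplus ∣ g := by
    rw [← Polynomial.map_dvd_map' φ, hfp]
    refine prod_X_sub_C_dvd hinj fun i hi => ?_
    obtain ⟨hi0, hil, -⟩ := hres i hi
    have hcop : i.Coprime l := (Nat.coprime_of_lt_prime hi0 hil hl).symm
    simpa [g, Polynomial.map_sum, eval_finsetSum] using
      (hprim.pow_of_coprime i hcop).geom_sum_eq_zero hl.one_lt
  -- `h` vanishes on the roots of `fplus` and is `1` on the other roots of `X ^ l - 1`.
  have hidem : X ^ l - 1 ∣ fplus * h - fplus := by
    rw [← Polynomial.map_dvd_map' φ]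
    simp only [Polynomial.map_sub, Polynomial.map_mul, Polynomial.map_pow, map_X,
      Polynomial.map_one]
    refine X_pow_sub_one_dvd hl.pos hprim fun i hi => ?_
    rw [eval_sub, eval_mul]
    by_cases hi1 : quadraticChar (ZMod l) (i : ZMod l) = 1
    · have hi0 : i ≠ 0 := by
        rintro rfl
        simp at hi1
      have hmem : i ∈ (Finset.Ico 1 l).filter (fun j : ℕ => legendreSym l (j : ℤ) = 1) := by
        simp only [Finset.mem_filter, Finset.mem_Ico, legendreSym, Int.cast_natCast]
        exact ⟨by omega, hi1⟩
      rw [hfp, eval_prod, Finset.prod_eq_zero hmem (by simp)]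
      simp
    · have hval := sum_pow_quadraticChar_of_not_residue l (by omega) hζ hroot hi1
      rw [ZMod.val_cast_of_lt hi] at hval
      rw [heval, hval, mul_one, sub_self]
  refine le_antisymm ?_ ?_
  · rw [Ideal.span_le]
    rintro x (rfl | rfl)
    · exact Ideal.mem_span_singleton.2 (map_dvd _ hfg)
    · exact Ideal.mem_span_singleton.2 (map_dvd _ hfh)
  · rw [Ideal.span_singleton_le_iff_mem,
      ← Ideal.Quotient.eq.2 (Ideal.mem_span_singleton.2 hidem), map_mul]
    exact Ideal.mul_mem_left _ _ (Ideal.subset_span (Or.inr rfl))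
end

section
/- Let r ≥ 1, R = ℤ/2^rℤ, and let t be an integer with t ≡ 1 (mod 4) and t² ≡ −l (mod 2^(r+2)). Let F ∈ R[X] be a monic polynomial of degree (l−1)/2 dividing X^l − 1 in R[X] whose reduction modulo 2 equals f₊ (i.e., F is the Hensel lift f₊^(r) of f₊ to R). Then in the quotient ring R[X]/(X^l − 1), the ideal generated by the images of g(X) = Σ_{j=0}^{l−1} X^j and h(X) = (1−t)/2 + Σ_{j : (j/l)=1} X^j equals the principal ideal generated by the image of F. In other words, the cyclic code over ℤ/2^rℤ generated by the all-ones word and the cyclic shifts of the word with entry (1−t)/2 at position 0, entry 1 at quadratic-residue positions, and 0 elsewhere, is the lifted quadratic residue code with generator polynomial f₊^(r). -/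
open Finset Polynomial

namespace QuadraticResidueCode

/-- The quadratic residues modulo `l`, as natural numbers in `[1, l)`. -/
def residues (l : ℕ) [Fact l.Prime] : Finset ℕ :=
  (Finset.Ico 1 l).filter (fun j : ℕ => legendreSym l (j : ℤ) = 1)

variable {l : ℕ} [Fact l.Prime]

lemma sum_range_eq_sum_zmod {A : Type*} [AddCommMonoid A] (f : ZMod l → A) :
    ∑ j ∈ range l, f j = ∑ x, f x := by
  refine Finset.sum_bij' (fun j _ => (j : ZMod l)) (fun x _ => x.val) ?_ ?_ ?_ ?_ ?_
  · simp
  · intro x _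
    exact Finset.mem_range.2 x.val_lt
  · intro j hj
    exact ZMod.val_cast_of_lt (Finset.mem_range.1 hj)
  · simp
  · simp

lemma two_mul_sum_residues_add_one {A : Type*} [CommRing A] (a : A) :
    2 * ∑ j ∈ residues l, a ^ j + 1 =
      ∑ j ∈ range l, (legendreSym l (j : ℤ) : A) * a ^ j + ∑ j ∈ range l, a ^ j := by
  have hl : 0 < l := (Fact.out : l.Prime).pos
  have h0 : legendreSym l ((0 : ℕ) : ℤ) = 0 := by simp [legendreSym]
  rw [← Finset.sum_add_distrib, Finset.range_eq_Ico, Finset.sum_eq_sum_Ico_succ_bot hl, h0,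
    residues, Finset.sum_filter, Finset.mul_sum, add_comm]
  congr 1
  · simp
  · refine Finset.sum_congr rfl fun j hj => ?_
    rw [zero_add, Finset.mem_Ico] at hj
    have hj0 : ((j : ℤ) : ZMod l) ≠ 0 := by
      rw [Int.cast_natCast, Ne, ZMod.natCast_eq_zero_iff]
      exact Nat.not_dvd_of_pos_of_lt hj.1 hj.2
    rcases legendreSym.eq_one_or_neg_one l hj0 with h | h
    · simp [h, two_mul]
    · norm_num [h]

lemma ringChar_zmod_ne_two (hl : l ≠ 2) : ringChar (ZMod l) ≠ 2 := by
  rwa [ZMod.ringChar_zmod_n]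

lemma sum_legendreSym (hl : l ≠ 2) : ∑ j ∈ range l, legendreSym l (j : ℤ) = 0 := by
  rw [← quadraticChar_sum_zero (ringChar_zmod_ne_two hl), ← sum_range_eq_sum_zmod]
  simp [legendreSym]

lemma two_mul_card_residues (hl : l ≠ 2) : 2 * #(residues l) + 1 = l := by
  have h := two_mul_sum_residues_add_one (l := l) (1 : ℤ)
  simp only [one_pow, mul_one, Int.cast_id, sum_legendreSym hl] at h
  simp only [sum_const, nsmul_eq_mul, mul_one, card_range, zero_add] at h
  exact_mod_cast h

lemma sum_legendreSym_mul_pow_sq {A : Type*} [CommRing A] [IsDomain A] [CharZero A]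
    (hl : l % 4 = 3) {a : A} (ha : IsPrimitiveRoot a l) :
    (∑ j ∈ range l, (legendreSym l (j : ℤ) : A) * a ^ j) ^ 2 = -l := by
  have hl2 : l ≠ 2 := by omega
  set χ : MulChar (ZMod l) A := (quadraticChar (ZMod l)).ringHomComp (Int.castRingHom A)
  have hχ : χ ≠ 1 :=
    (MulChar.ringHomComp_ne_one_iff (Int.castRingHom A).injective_int).2
      (quadraticChar_ne_one (ringChar_zmod_ne_two hl2))
  have h := gaussSum_sq hχ ((quadraticChar_isQuadratic _).comp _)
    (AddChar.zmodChar_primitive_of_primitive_root l ha)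
  rw [gaussSum, ← sum_range_eq_sum_zmod] at h
  have hneg : χ (-1) = -1 := by
    have := legendreSym.at_neg_one hl2
    rw [ZMod.χ₄_nat_three_mod_four hl, legendreSym] at this
    simp only [Int.cast_neg, Int.cast_one] at this
    simp [χ, MulChar.ringHomComp_apply, this]
  rw [hneg, ZMod.card, neg_one_mul] at h
  rw [← h]
  congr 1
  refine Finset.sum_congr rfl fun j _ => ?_
  rw [AddChar.zmodChar_apply']
  simp [χ, legendreSym, MulChar.ringHomComp_apply]

/-- The sum of the residue powers of an `l`-th root of unity satisfies a quadratic equation. -/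
lemma four_mul_sum_residues_quadratic {A : Type*} [CommRing A] [IsDomain A] [CharZero A]
    (hl : l % 4 = 3) {a : A} (ha : a ^ l = 1) :
    4 * ((∑ j ∈ residues l, a ^ j) ^ 2 + ∑ j ∈ residues l, a ^ j) + (l + 1) =
      (l + 1) * ∑ j ∈ range l, a ^ j := by
  have hp : l.Prime := Fact.out
  have h := two_mul_sum_residues_add_one (l := l) a
  by_cases ha1 : a = 1
  · subst ha1
    have hc : (2 * #(residues l) + 1 : A) = l := by
      exact_mod_cast congrArg (Nat.cast : ℕ → A) (two_mul_card_residues (l := l) (by omega))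
    simp only [one_pow, sum_const, nsmul_eq_mul, mul_one, card_range]
    linear_combination (2 * (#(residues l) : A) + 1 + l) * hc
  · have hprim : IsPrimitiveRoot a l := by
      have := orderOf_eq_prime ha ha1
      exact this ▸ IsPrimitiveRoot.orderOf a
    have hsq := sum_legendreSym_mul_pow_sq hl hprim
    rw [hprim.geom_sum_eq_zero hp.one_lt] at h ⊢
    set s := ∑ j ∈ range l, (legendreSym l (j : ℤ) : A) * a ^ j
    set q := ∑ j ∈ residues l, a ^ j
    linear_combination (2 * q + 1 + s) * h + hsq

lemma X_pow_sub_one_dvd_int (hl : l % 4 = 3) :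
    (X : ℤ[X]) ^ l - 1 ∣ (∑ j ∈ residues l, X ^ j) ^ 2 + ∑ j ∈ residues l, X ^ j +
      (((l + 1) / 4 : ℕ) : ℤ[X]) * (1 - ∑ j ∈ range l, X ^ j) := by
  have hp : l.Prime := Fact.out
  have hm : ((4 : ℂ) * ((l + 1) / 4 : ℕ)) = l + 1 := by
    exact_mod_cast congrArg (Nat.cast : ℕ → ℂ) (by omega : 4 * ((l + 1) / 4) = l + 1)
  rw [← Polynomial.map_dvd_map (Int.castRingHom ℂ) (Int.castRingHom ℂ).injective_int
    (by simpa using monic_X_pow_sub_C (1 : ℤ) hp.ne_zero)]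
  have hω := Complex.isPrimitiveRoot_exp l hp.ne_zero
  simp only [Polynomial.map_sub, Polynomial.map_pow, map_X, Polynomial.map_one,
    X_pow_sub_one_eq_prod hp.pos hω]
  refine Finset.prod_dvd_of_coprime
    ((pairwise_coprime_X_sub_C Function.injective_id).set_pairwise _) fun a ha => ?_
  rw [mem_nthRootsFinset hp.pos] at ha
  rw [dvd_iff_isRoot, IsRoot.def]
  have h := four_mul_sum_residues_quadratic hl ha
  simp only [Polynomial.map_add, Polynomial.map_mul, Polynomial.map_sub, Polynomial.map_pow,
    Polynomial.map_sum, map_X, Polynomial.map_one, Polynomial.map_natCast, eval_add, eval_mul,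
    eval_sub, eval_pow, eval_finsetSum, eval_X, eval_one, eval_natCast]
  refine mul_left_cancel₀ (by norm_num : (4 : ℂ) ≠ 0) ?_
  linear_combination h + (1 - ∑ j ∈ range l, a ^ j) * hm

/-- The relation satisfied by the residue polynomial modulo `X ^ l - 1`. -/
lemma X_pow_sub_one_dvd (R : Type*) [CommRing R] (hl : l % 4 = 3) :
    (X : R[X]) ^ l - 1 ∣ (∑ j ∈ residues l, X ^ j) ^ 2 + ∑ j ∈ residues l, X ^ j +
      (((l + 1) / 4 : ℕ) : R[X]) * (1 - ∑ j ∈ range l, X ^ j) := by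
  have h := Polynomial.map_dvd (Int.castRingHom R) (X_pow_sub_one_dvd_int hl)
  generalize (l + 1) / 4 = m at h ⊢
  simpa [Polynomial.map_sum] using h


lemma sum_residues_eq_sum_zmod {A : Type*} [AddCommMonoid A] (f : ZMod l → A) :
    ∑ j ∈ residues l, f j = ∑ x with quadraticChar (ZMod l) x = 1, f x := by
  have h : residues l = (range l).filter (fun j : ℕ => legendreSym l (j : ℤ) = 1) := by
    ext j
    rcases j.eq_zero_or_pos with rfl | hj
    · simp [residues, legendreSym]
    · simp [residues, Nat.one_le_iff_ne_zero.2 hj.ne']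
  rw [h, Finset.sum_filter, Finset.sum_filter, ← sum_range_eq_sum_zmod]
  simp [legendreSym]

/-- Raising an `l`-th root of unity to the power `j` permutes the quadratic classes. -/
lemma sum_residues_pow_pow {A : Type*} [CommRing A] {ζ : A} (hζ : ζ ^ l = 1) {j : ℕ}
    (hj : (j : ZMod l) ≠ 0) :
    ∑ i ∈ residues l, (ζ ^ j) ^ i =
      ∑ x with quadraticChar (ZMod l) x = quadraticChar (ZMod l) j,
        AddChar.zmodChar l hζ x := by
  have h : ∀ i ∈ residues l, (ζ ^ j) ^ i = AddChar.zmodChar l hζ ((j : ZMod l) * i) := by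
    intro i _
    rw [← Nat.cast_mul, AddChar.zmodChar_apply', pow_mul]
  rw [Finset.sum_congr rfl h,
    sum_residues_eq_sum_zmod (fun x => AddChar.zmodChar l hζ ((j : ZMod l) * x))]
  have hχ : quadraticChar (ZMod l) j ≠ 0 := by rwa [Ne, quadraticChar_eq_zero_iff]
  refine Finset.sum_bij' (fun x _ => (j : ZMod l) * x) (fun x _ => (j : ZMod l)⁻¹ * x)
    ?_ ?_ ?_ ?_ ?_
  · intro x hx
    rw [Finset.mem_filter_univ] at hx ⊢
    rw [map_mul, hx, mul_one]
  · intro x hx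
    rw [Finset.mem_filter_univ] at hx ⊢
    refine mul_left_cancel₀ hχ ?_
    rw [← map_mul, mul_inv_cancel_left₀ hj, hx, mul_one]
  · intro x _
    exact inv_mul_cancel_left₀ hj x
  · intro x _
    exact mul_inv_cancel_left₀ hj x
  · intro x _
    rfl

lemma sum_zmodChar_classes {A : Type*} [CommRing A] [IsDomain A] {ζ : A}
    (hζ : IsPrimitiveRoot ζ l) :
    ∑ x with quadraticChar (ZMod l) x = 1, AddChar.zmodChar l hζ.pow_eq_one x +
      ∑ x with quadraticChar (ZMod l) x = -1, AddChar.zmodChar l hζ.pow_eq_one x = -1 := by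
  set ψ := AddChar.zmodChar l hζ.pow_eq_one
  have h0 : ∑ x, ψ x = 0 := by
    rw [← sum_range_eq_sum_zmod]
    simp only [ψ, AddChar.zmodChar_apply']
    exact hζ.geom_sum_eq_zero (Fact.out : l.Prime).one_lt
  have h : ∀ x : ZMod l, ψ x = (if quadraticChar (ZMod l) x = 1 then ψ x else 0) +
      (if quadraticChar (ZMod l) x = -1 then ψ x else 0) + if x = 0 then 1 else 0 := by
    intro x
    by_cases hx : x = 0
    · simp [hx]
    · rcases quadraticChar_dichotomy hx with h | h <;> simp [h, hx]
  rw [Finset.sum_congr rfl fun x _ => h x, Finset.sum_add_distrib, Finset.sum_add_distrib,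
    ← Finset.sum_filter, ← Finset.sum_filter, Finset.sum_ite_eq' univ (0 : ZMod l)] at h0
  simp only [mem_univ, if_true] at h0
  exact eq_neg_of_add_eq_zero_left h0

section Field

variable {K : Type*} [Field K] {ζ : K}

lemma sum_residues_pow_eq_zero (hζ : IsPrimitiveRoot ζ l) (h0 : ∑ j ∈ residues l, ζ ^ j = 0)
    {j : ℕ} (hj : j ∈ residues l) : ∑ i ∈ residues l, (ζ ^ j) ^ i = 0 := by
  have hj1 : quadraticChar (ZMod l) j = 1 := by
    simpa [legendreSym] using (Finset.mem_filter.1 hj).2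
  have hj0 : (j : ZMod l) ≠ 0 := by
    rintro h
    simp [h] at hj1
  have h := sum_residues_pow_pow hζ.pow_eq_one (j := 1) (by simp)
  rw [Nat.cast_one, map_one, pow_one, h0] at h
  rw [sum_residues_pow_pow hζ.pow_eq_one hj0, hj1, ← h]

lemma sum_residues_pow_ne_zero [CharP K 2] (hl : l % 4 = 3) (hζ : IsPrimitiveRoot ζ l)
    (h0 : ∑ j ∈ residues l, ζ ^ j = 0)
    {j : ℕ} (hjl : j < l) (hj : j ∉ residues l) : ∑ i ∈ residues l, (ζ ^ j) ^ i ≠ 0 := by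
  rcases j.eq_zero_or_pos with rfl | hpos
  · have hc := two_mul_card_residues (l := l) (by omega)
    simp only [pow_zero, one_pow, sum_const, nsmul_eq_mul, mul_one, Ne]
    rw [CharP.cast_eq_zero_iff K 2]
    omega
  · have hj0 : (j : ZMod l) ≠ 0 := by
      rw [Ne, ZMod.natCast_eq_zero_iff]
      exact Nat.not_dvd_of_pos_of_lt hpos hjl
    have hj1 : quadraticChar (ZMod l) j = -1 := by
      refine (quadraticChar_dichotomy hj0).resolve_left fun h => hj ?_
      rw [residues, Finset.mem_filter, Finset.mem_Ico, legendreSym, Int.cast_natCast]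
      exact ⟨⟨hpos, hjl⟩, h⟩
    have h := sum_residues_pow_pow hζ.pow_eq_one (j := 1) (by simp)
    rw [Nat.cast_one, map_one, pow_one, h0] at h
    have hs := sum_zmodChar_classes hζ
    rw [← h, zero_add] at hs
    rw [sum_residues_pow_pow hζ.pow_eq_one hj0, hj1, hs]
    simp

lemma X_pow_sub_one_eq_prod_range (hζ : IsPrimitiveRoot ζ l) :
    (X : K[X]) ^ l - 1 = ∏ j ∈ range l, (X - C (ζ ^ j)) := by
  have hp : l.Prime := Fact.out
  rw [X_pow_sub_one_eq_prod hp.pos hζ]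
  symm
  refine Finset.prod_bij (fun j _ => ζ ^ j) ?_ ?_ ?_ ?_
  · intro j _
    rw [mem_nthRootsFinset hp.pos, ← pow_mul, mul_comm, pow_mul, hζ.pow_eq_one, one_pow]
  · intro i hi j hj h
    exact hζ.pow_inj (Finset.mem_range.1 hi) (Finset.mem_range.1 hj) h
  · intro a ha
    rw [mem_nthRootsFinset hp.pos] at ha
    obtain ⟨i, hi, rfl⟩ := hζ.eq_pow_of_pow_eq_one ha
    exact ⟨i, Finset.mem_range.2 hi, rfl⟩
  · intro _ _
    rfl

lemma prod_residues_dvd (hζ : IsPrimitiveRoot ζ l) (h0 : ∑ j ∈ residues l, ζ ^ j = 0) :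
    ∏ j ∈ residues l, (X - C (ζ ^ j)) ∣ ∑ j ∈ residues l, (X : K[X]) ^ j := by
  refine Finset.prod_dvd_of_coprime (fun i hi j hj hij => ?_) fun j hj => ?_
  · have hlt : ∀ k ∈ residues l, k < l := fun k hk =>
      (Finset.mem_Ico.1 (Finset.mem_filter.1 hk).1).2
    exact pairwise_coprime_X_sub_C Function.injective_id
      fun h => hij (hζ.pow_inj (hlt i hi) (hlt j hj) h)
  · rw [dvd_iff_isRoot, IsRoot.def, eval_finsetSum]
    simpa using sum_residues_pow_eq_zero hζ h0 hj

lemma isCoprime_X_sub_C_of_eval_ne_zero {p : K[X]} {a : K} (h : p.eval a ≠ 0) :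
    IsCoprime p (X - C a) := by
  rw [isCoprime_comm, (irreducible_X_sub_C a).coprime_iff_not_dvd, dvd_iff_isRoot]
  exact h

lemma isCoprime_of_prod_residues_mul_eq [CharP K 2] (hl : l % 4 = 3) (hζ : IsPrimitiveRoot ζ l)
    (h0 : ∑ j ∈ residues l, ζ ^ j = 0) {q : K[X]}
    (hq : (∏ j ∈ residues l, (X - C (ζ ^ j))) * q = X ^ l - 1) :
    IsCoprime (∑ j ∈ residues l, (X : K[X]) ^ j) q := by
  have hsub : residues l ⊆ range l := fun j hj =>
    Finset.mem_range.2 (Finset.mem_Ico.1 (Finset.mem_filter.1 hj).1).2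
  have hq' : q = ∏ j ∈ range l \ residues l, (X - C (ζ ^ j)) := by
    refine mul_left_cancel₀ (Finset.prod_ne_zero_iff.2 fun (j : ℕ) (_ : j ∈ residues l) =>
      X_sub_C_ne_zero (ζ ^ j)) ?_
    rw [hq, X_pow_sub_one_eq_prod_range hζ, mul_comm, Finset.prod_sdiff hsub]
  rw [hq']
  refine IsCoprime.prod_right fun j hj => isCoprime_X_sub_C_of_eval_ne_zero ?_
  rw [Finset.mem_sdiff, Finset.mem_range] at hj
  simpa [eval_finsetSum] using sum_residues_pow_ne_zero hl hζ h0 hj.1 hj.2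

lemma isCoprime_prod_residues_X_sub_one (hζ : IsPrimitiveRoot ζ l) :
    IsCoprime (∏ j ∈ residues l, (X - C (ζ ^ j))) (X - C 1) := by
  refine isCoprime_X_sub_C_of_eval_ne_zero ?_
  rw [eval_prod, Finset.prod_ne_zero_iff]
  intro j hj
  have hj' := Finset.mem_Ico.1 (Finset.mem_filter.1 hj).1
  rw [eval_sub, eval_X, eval_C, sub_ne_zero]
  exact (hζ.pow_ne_one_of_pos_of_lt (by omega) hj'.2).symm

end Field

section NilpotentKernel

variable {R S : Type*} [CommRing R] [CommRing S] {f : R →+* S}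

lemma isNilpotent_of_map_eq_zero (hf : ∀ x, f x = 0 → IsNilpotent x) {p : R[X]}
    (hp : p.map f = 0) : IsNilpotent p := by
  refine Polynomial.isNilpotent_iff.2 fun i => hf _ ?_
  rw [← coeff_map, hp, coeff_zero]

lemma isUnit_of_map_isUnit (hf : ∀ x, f x = 0 → IsNilpotent x)
    (hsurj : Function.Surjective f) {p : R[X]} (hp : IsUnit (p.map f)) : IsUnit p := by
  obtain ⟨q', hq'⟩ := hp.exists_right_inv
  obtain ⟨q, rfl⟩ := Polynomial.map_surjective f hsurj q'
  have h : IsNilpotent (p * q - 1) := isNilpotent_of_map_eq_zero hf (by simp [hq'])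
  have hu := h.isUnit_add_one
  rw [sub_add_cancel] at hu
  exact isUnit_of_mul_isUnit_left hu

lemma isCoprime_of_map (hf : ∀ x, f x = 0 → IsNilpotent x)
    (hsurj : Function.Surjective f) {p q : R[X]} (h : IsCoprime (p.map f) (q.map f)) :
    IsCoprime p q := by
  obtain ⟨a', b', hab⟩ := h
  obtain ⟨a, rfl⟩ := Polynomial.map_surjective f hsurj a'
  obtain ⟨b, rfl⟩ := Polynomial.map_surjective f hsurj b'
  have hu : IsUnit (a * p + b * q) :=
    isUnit_of_map_isUnit hf hsurj (by simp [hab])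
  obtain ⟨c, hc⟩ := hu.exists_left_inv
  exact ⟨c * a, c * b, by linear_combination hc⟩

/-- If `h (h + t) ∈ (d)`, `t` is a unit and `h` is divisible by `d` modulo a nil ideal, then
`d` divides `h`. -/
lemma dvd_of_dvd_mul_add (hf : ∀ x, f x = 0 → IsNilpotent x)
    (hsurj : Function.Surjective f) {d h t : R[X]} (ht : IsUnit t)
    (hdvd : d.map f ∣ h.map f) (hmul : d ∣ h * (h + t)) : d ∣ h := by
  obtain ⟨s', hs'⟩ := hdvd
  obtain ⟨s, rfl⟩ := Polynomial.map_surjective f hsurj s'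
  have hn : IsNilpotent (h - d * s) := isNilpotent_of_map_eq_zero hf (by simp [hs'])
  obtain ⟨u, hu⟩ := (hn.isUnit_add_left_of_commute ht (Commute.all _ _)).exists_right_inv
  obtain ⟨k, hk⟩ := hmul
  exact ⟨k * u - h * s * u, by linear_combination u * hk - h * hu⟩

end NilpotentKernel

lemma isNilpotent_of_castHom_eq_zero {r : ℕ} (hr : 2 ∣ 2 ^ r) (x : ZMod (2 ^ r))
    (hx : ZMod.castHom hr (ZMod 2) x = 0) : IsNilpotent x := by
  obtain ⟨n, rfl⟩ := ZMod.natCast_zmod_surjective x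
  rw [map_natCast, ZMod.natCast_eq_zero_iff] at hx
  obtain ⟨m, rfl⟩ := hx
  refine ⟨r, ?_⟩
  rw [← Nat.cast_pow, ZMod.natCast_eq_zero_iff, mul_pow]
  exact dvd_mul_right _ _

end QuadraticResidueCode

/-- Theorem 9: for `r ≥ 1` and `R = ℤ/2^rℤ`, with `t ≡ 1 (mod 4)`, `t² ≡ -l (mod 2^(r+2))`,
and `F` the Hensel lift of `f₊` to `R`, in `R[X]/(X^l - 1)` the ideal generated by
`g(X) = Σ_{j<l} X^j` and `h(X) = (1-t)/2 + Σ_{(j/l)=1} X^j` is the principal ideal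
generated by `F`, i.e. the cyclic code over `ℤ/2^rℤ` generated by the all-ones word and
the shifts of the word `h` is the lifted quadratic residue code with generator `f₊^(r)`. -/
theorem stmt_16 (l : ℕ) [Fact (Nat.Prime l)] (hl7 : l % 8 = 7)
    (F : Type*) [Field F] [CharP F 2] (φ : ZMod 2 →+* F)
    (ζ : F) (hζ : orderOf ζ = l)
    (hchoice : (∑ j ∈ (Finset.Ico 1 l).filter (fun j : ℕ => legendreSym l (j : ℤ) = 1),
      ζ ^ j) = 0)
    (fplus : Polynomial (ZMod 2))
    (hfp : fplus.map φ =
      ∏ j ∈ (Finset.Ico 1 l).filter (fun j : ℕ => legendreSym l (j : ℤ) = 1),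
        (X - C (ζ ^ j)))
    (r : ℕ) (hr : 1 ≤ r)
    (t : ℤ) (ht1 : (4 : ℤ) ∣ t - 1) (ht2 : (2 ^ (r + 2) : ℤ) ∣ t ^ 2 + l)
    (Fr : Polynomial (ZMod (2 ^ r)))
    (hFmonic : Fr.Monic) (hFdeg : Fr.natDegree = (l - 1) / 2)
    (hFdvd : Fr ∣ (X : Polynomial (ZMod (2 ^ r))) ^ l - 1)
    (hFred : Fr.map (ZMod.castHom (dvd_pow_self 2 (Nat.one_le_iff_ne_zero.mp hr))
      (ZMod 2)) = fplus) :
    Ideal.span {Ideal.Quotient.mk (Ideal.span {(X : Polynomial (ZMod (2 ^ r))) ^ l - 1})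
        (∑ j ∈ Finset.range l, X ^ j),
      Ideal.Quotient.mk (Ideal.span {(X : Polynomial (ZMod (2 ^ r))) ^ l - 1})
        (C (((1 - t) / 2 : ℤ) : ZMod (2 ^ r)) +
          ∑ j ∈ (Finset.Ico 1 l).filter (fun j : ℕ => legendreSym l (j : ℤ) = 1), X ^ j)} =
    Ideal.span {Ideal.Quotient.mk (Ideal.span {(X : Polynomial (ZMod (2 ^ r))) ^ l - 1})
        Fr} := by
  change Ideal.span {Ideal.Quotient.mk _ (∑ j ∈ Finset.range l, X ^ j), Ideal.Quotient.mk _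
    (C (((1 - t) / 2 : ℤ) : ZMod (2 ^ r)) +
      ∑ j ∈ QuadraticResidueCode.residues l, X ^ j)} = _
  change ∑ j ∈ QuadraticResidueCode.residues l, ζ ^ j = 0 at hchoice
  change fplus.map φ = ∏ j ∈ QuadraticResidueCode.residues l, (X - C (ζ ^ j)) at hfp
  have hl4 : l % 4 = 3 := by omega
  have hprim : IsPrimitiveRoot ζ l := hζ ▸ IsPrimitiveRoot.orderOf ζ
  set π := ZMod.castHom (dvd_pow_self 2 (Nat.one_le_iff_ne_zero.mp hr)) (ZMod 2)
  have hker : ∀ x, π x = 0 → IsNilpotent x :=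
    QuadraticResidueCode.isNilpotent_of_castHom_eq_zero _
  have hsurj : Function.Surjective π := ZMod.ringHom_surjective π
  set g : (ZMod (2 ^ r))[X] := ∑ j ∈ Finset.range l, X ^ j
  obtain ⟨u, hu⟩ := ht1
  obtain ⟨v, hv⟩ := ht2
  obtain rfl : t = 4 * u + 1 := by linarith
  have hc : (1 - (4 * u + 1)) / 2 = -2 * u := by omega
  rw [hc]
  set h : (ZMod (2 ^ r))[X] :=
    C ((-2 * u : ℤ) : ZMod (2 ^ r)) + ∑ j ∈ QuadraticResidueCode.residues l, X ^ j with h_def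
  have hhπ : (h.map π).map φ = ∑ j ∈ QuadraticResidueCode.residues l, X ^ j := by
    have h2 : ((-2 * u : ℤ) : ZMod 2) = 0 :=
      (ZMod.intCast_zmod_eq_zero_iff_dvd _ _).2 ⟨-u, by push_cast; ring⟩
    rw [h_def, Polynomial.map_add, map_C, map_intCast, h2]
    simp [Polynomial.map_sum]
  obtain ⟨K, hK⟩ := hFdvd
  have hFg : Fr ∣ g := by
    have hcop : IsCoprime Fr (X - 1) := by
      refine QuadraticResidueCode.isCoprime_of_map hker hsurj ?_
      rw [hFred, ← Polynomial.isCoprime_map φ, hfp]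
      simpa using QuadraticResidueCode.isCoprime_prod_residues_X_sub_one hprim
    refine hcop.dvd_of_dvd_mul_right ⟨K, ?_⟩
    rw [← hK, geom_sum_mul]
  have hFh : Fr ∣ h := by
    have ht : IsUnit (C ((4 * u + 1 : ℤ) : ZMod (2 ^ r))) := by
      refine QuadraticResidueCode.isUnit_of_map_isUnit hker hsurj ?_
      have h1 : ((4 * u + 1 : ℤ) : ZMod 2) = 1 := by
        have h2 : (2 : ZMod 2) = 0 := rfl
        push_cast
        linear_combination 2 * (u : ZMod 2) * h2
      rw [map_C, map_intCast, h1, C_1]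
      exact isUnit_one
    refine QuadraticResidueCode.dvd_of_dvd_mul_add hker hsurj ht ?_ ?_
    · rw [hFred, ← Polynomial.map_dvd_map' φ, hhπ, hfp]
      exact QuadraticResidueCode.prod_residues_dvd hprim hchoice
    · obtain ⟨k, hk⟩ := QuadraticResidueCode.X_pow_sub_one_dvd (ZMod (2 ^ r)) hl4
      have hm : (((l + 1) / 4 : ℕ) : ℤ) = 2 ^ r * v - 4 * u ^ 2 - 2 * u := by
        have : (4 * ((l + 1) / 4 : ℕ) : ℤ) = l + 1 := by omega
        rw [pow_add] at hv
        linarith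
      generalize (l + 1) / 4 = m at hk hm
      have hm' : (m : (ZMod (2 ^ r))[X]) = -4 * (u : (ZMod (2 ^ r))[X]) ^ 2 -
          2 * u := by
        have h0 : (2 : (ZMod (2 ^ r))[X]) ^ r = 0 := by
          have := CharP.cast_eq_zero (ZMod (2 ^ r))[X] (2 ^ r)
          exact_mod_cast this
        have := congrArg (Int.cast : ℤ → (ZMod (2 ^ r))[X]) hm
        push_cast at this
        rw [this, h0]
        ring
      obtain ⟨w, hw⟩ := hFg
      refine ⟨K * k + (m : (ZMod (2 ^ r))[X]) * w, ?_⟩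
      rw [h_def]
      change _ + _ * (1 - g) = _ at hk
      simp only [map_intCast]
      push_cast
      linear_combination hk + k * hK + (m : (ZMod (2 ^ r))[X]) * hw - hm'
  have hcop : IsCoprime h K := by
    refine QuadraticResidueCode.isCoprime_of_map hker hsurj ?_
    rw [← Polynomial.isCoprime_map φ, hhπ]
    refine QuadraticResidueCode.isCoprime_of_prod_residues_mul_eq hl4 hprim hchoice ?_
    rw [← hfp, ← hFred, ← Polynomial.map_mul, ← Polynomial.map_mul, ← hK]
    simp
  refine le_antisymm (Ideal.span_le.2 ?_) ?_
  · rintro x (rfl | rfl)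
    · exact Ideal.mem_span_singleton.2 (map_dvd _ hFg)
    · exact Ideal.mem_span_singleton.2 (map_dvd _ hFh)
  · rw [Ideal.span_singleton_le_iff_mem]
    obtain ⟨a, b, hab⟩ := hcop
    have hF : Ideal.Quotient.mk (Ideal.span {(X : (ZMod (2 ^ r))[X]) ^ l - 1}) Fr =
        Ideal.Quotient.mk _ (a * Fr) * Ideal.Quotient.mk _ h := by
      rw [← map_mul, Ideal.Quotient.mk_eq_mk_iff_sub_mem, Ideal.mem_span_singleton]
      exact ⟨b, by linear_combination -Fr * hab - b * hK⟩
    rw [hF]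
    exact Ideal.mul_mem_left _ _ (Ideal.subset_span (Or.inr rfl))
end
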